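/- arXiv:2312.14019 — 4 statements merged into one kernel-verified Lean document; each statement's English description precedes it below -/
import Mathlib

section
/- Let A ⊆ M_d(ℂ) be a hermitian-closed unital subalgebra. For every X ∈ M_d(ℂ), the Haar average ∫_{U(A)} U X U† dU (integration with respect to the normalized Haar probability measure on the compact group U(A)) equals the orthogonal projection, with respect to the Frobenius inner product, of X onto the commutant A'. -/
open MeasureTheory Matrix Kronecker

noncomputable section

instance matMeasurableSpace (n : Type*) [Fintype n] : MeasurableSpace (Matrix n n ℂ) :=
  show MeasurableSpace (n → n → ℂ) from inferInstance

/-- Squared Frobenius (Hilbert-Schmidt) norm `‖X‖₂² = Tr(X† X)`. -/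
def hs2 {n : Type*} [Fintype n] (X : Matrix n n ℂ) : ℝ := (Matrix.trace (Xᴴ * X)).re

/-- Mutual Averaged Non-commutativity: `(1/(2d)) ∫∫ ‖UV - VU‖₂² dμ(U) dν(V)`,
where `μ`, `ν` are meant to be the normalized Haar measures of the unitary groups of
the two algebras (imposed by the `IsHaar` hypotheses in the theorems below). -/
def MAN {n : Type*} [Fintype n] (μ ν : Measure (Matrix n n ℂ)) : ℝ :=
  (1 / (2 * (Fintype.card n : ℝ))) * ∫ U, ∫ V, hs2 (U * V - V * U) ∂ν ∂μ

/-- `μ` is the normalized Haar probability measure of the compact unitary group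
`U(A) = {U ∈ A : U†U = UU† = 1}` of the star-subalgebra `A`, viewed as a measure on
matrix space concentrated on `U(A)` and invariant under left translation by `U(A)`. -/
def IsHaar {n : Type*} [Fintype n] [DecidableEq n] (A : StarSubalgebra ℂ (Matrix n n ℂ))
    (μ : Measure (Matrix n n ℂ)) : Prop :=
  IsProbabilityMeasure μ ∧
  μ {U | ¬ (U ∈ A ∧ U ∈ unitary (Matrix n n ℂ))} = 0 ∧
  ∀ U ∈ A, U ∈ unitary (Matrix n n ℂ) → μ.map (fun V => U * V) = μ

/-- A star-subalgebra of a matrix algebra is spanned by its unitary elements. -/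
theorem StarSubalgebra.mem_span_unitary {n : Type*} [Fintype n] [DecidableEq n]
    (A : StarSubalgebra ℂ (Matrix n n ℂ)) {Y : Matrix n n ℂ} (hY : Y ∈ A) :
    Y ∈ Submodule.span ℂ {U : Matrix n n ℂ | U ∈ A ∧ U ∈ unitary (Matrix n n ℂ)} := by
  open scoped Matrix.Norms.L2Operator in
  have : IsClosed (A : Set (Matrix n n ℂ)) :=
    Submodule.closed_of_finiteDimensional (Subalgebra.toSubmodule A.toSubalgebra)
  obtain ⟨u, c, hu, -⟩ := CStarAlgebra.exists_sum_four_unitary (⟨Y, hY⟩ : A)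
  have hsum : Y = ∑ i, c i • ((u i : A) : Matrix n n ℂ) := by
    simpa using congrArg A.subtype hu
  rw [hsum]
  refine sum_mem fun i _ ↦ Submodule.smul_mem _ _ (Submodule.subset_span ⟨(u i : A).2, ?_⟩)
  exact Unitary.map_mem A.subtype (u i).2

theorem measurable_matrix_apply {n : Type*} [Fintype n] (i j : n) :
    Measurable fun U : Matrix n n ℂ ↦ U i j :=
  (measurable_pi_apply j).comp (measurable_pi_apply i)

theorem measurable_matrix_mul_left {n : Type*} [Fintype n] (V : Matrix n n ℂ) :
    Measurable fun U : Matrix n n ℂ ↦ V * U := by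
  refine measurable_pi_iff.2 fun i ↦ measurable_pi_iff.2 fun j ↦ ?_
  simp only [Matrix.mul_apply]
  exact Finset.measurable_sum _ fun k _ ↦ (measurable_matrix_apply k j).const_mul _

theorem measurable_conj_apply {n : Type*} [Fintype n] (X : Matrix n n ℂ) (i j : n) :
    Measurable fun U : Matrix n n ℂ ↦ (U * X * Uᴴ) i j := by
  simp only [Matrix.mul_apply, Matrix.conjTranspose_apply]
  exact Finset.measurable_sum _ fun k _ ↦ (Finset.measurable_sum _ fun l _ ↦
    (measurable_matrix_apply i l).mul_const _).mul
      (continuous_star.measurable.comp (measurable_matrix_apply j k))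

theorem norm_conj_apply_le {n : Type*} [Fintype n] [DecidableEq n] {U : Matrix n n ℂ}
    (hU : U ∈ unitary (Matrix n n ℂ)) (X : Matrix n n ℂ) (i j : n) :
    ‖(U * X * Uᴴ) i j‖ ≤ ∑ k, ∑ l, ‖X l k‖ := by
  simp only [Matrix.mul_apply, Matrix.conjTranspose_apply]
  refine norm_sum_le_of_le _ fun k _ ↦ ?_
  rw [norm_mul, norm_star]
  refine (mul_le_of_le_one_right (norm_nonneg _) (entry_norm_bound_of_unitary hU j k)).trans ?_
  refine norm_sum_le_of_le _ fun l _ ↦ ?_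
  rw [norm_mul]
  exact mul_le_of_le_one_left (norm_nonneg _) (entry_norm_bound_of_unitary hU i l)

namespace IsHaar

variable {n : Type*} [Fintype n] [DecidableEq n] {A : StarSubalgebra ℂ (Matrix n n ℂ)}
  {μ : Measure (Matrix n n ℂ)}

theorem ae_mem (hμ : IsHaar A μ) : ∀ᵐ U ∂μ, U ∈ A ∧ U ∈ unitary (Matrix n n ℂ) :=
  ae_iff.2 hμ.2.1

theorem integrable_conj_apply (hμ : IsHaar A μ) (X : Matrix n n ℂ) (i j : n) :
    Integrable (fun U ↦ (U * X * Uᴴ) i j) μ := by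
  have := hμ.1
  refine Integrable.of_bound (measurable_conj_apply X i j).aestronglyMeasurable
    (∑ k, ∑ l, ‖X l k‖) ?_
  filter_upwards [hμ.ae_mem] with U hU
  exact norm_conj_apply_le hU.2 X i j

/-- Linear functionals commute with the Haar average. -/
theorem map_average (hμ : IsHaar A μ) {X M : Matrix n n ℂ}
    (hM : ∀ i j, M i j = ∫ U, (U * X * Uᴴ) i j ∂μ) (L : Matrix n n ℂ →ₗ[ℂ] ℂ) :
    L M = ∫ U, L (U * X * Uᴴ) ∂μ := by
  have hL (N : Matrix n n ℂ) : L N = ∑ i, ∑ j, N i j * L (Matrix.single i j 1) := by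
    conv_lhs => rw [Matrix.matrix_eq_sum_single N]
    simp only [map_sum]
    refine Finset.sum_congr rfl fun i _ ↦ Finset.sum_congr rfl fun j _ ↦ ?_
    rw [← smul_eq_mul, ← map_smul, Matrix.smul_single, smul_eq_mul, mul_one]
  have hint (i j : n) :
      Integrable (fun U ↦ (U * X * Uᴴ) i j * L (Matrix.single i j 1)) μ :=
    (hμ.integrable_conj_apply X i j).mul_const _
  rw [hL M, integral_congr_ae (ae_of_all μ fun U ↦ hL (U * X * Uᴴ)),
    integral_finsetSum _ fun i _ ↦ integrable_finsetSum _ fun j _ ↦ hint i j]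
  refine Finset.sum_congr rfl fun i _ ↦ ?_
  rw [integral_finsetSum _ fun j _ ↦ hint i j]
  refine Finset.sum_congr rfl fun j _ ↦ ?_
  rw [integral_mul_const, hM]

/-- The Haar average is fixed under conjugation by unitaries of the algebra. -/
theorem conj_average (hμ : IsHaar A μ) {X M : Matrix n n ℂ}
    (hM : ∀ i j, M i j = ∫ U, (U * X * Uᴴ) i j ∂μ) {V : Matrix n n ℂ} (hVA : V ∈ A)
    (hV : V ∈ unitary (Matrix n n ℂ)) : V * M * Vᴴ = M := by
  ext i j
  let L : Matrix n n ℂ →ₗ[ℂ] ℂ :=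
    Matrix.entryLinearMap ℂ ℂ i j ∘ₗ LinearMap.mulRight ℂ Vᴴ ∘ₗ LinearMap.mulLeft ℂ V
  calc (V * M * Vᴴ) i j = ∫ U, (V * (U * X * Uᴴ) * Vᴴ) i j ∂μ := hμ.map_average hM L
    _ = ∫ U, ((V * U) * X * (V * U)ᴴ) i j ∂μ := by
      simp only [Matrix.conjTranspose_mul, Matrix.mul_assoc]
    _ = ∫ U, (U * X * Uᴴ) i j ∂(μ.map fun U ↦ V * U) :=
      (integral_map (measurable_matrix_mul_left V).aemeasurable
        (measurable_conj_apply X i j).aestronglyMeasurable).symm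
    _ = M i j := by rw [hμ.2.2 V hVA hV, hM]

theorem commute_average (hμ : IsHaar A μ) {X M : Matrix n n ℂ}
    (hM : ∀ i j, M i j = ∫ U, (U * X * Uᴴ) i j ∂μ) {Y : Matrix n n ℂ} (hY : Y ∈ A) :
    Commute M Y := by
  have hspan := A.mem_span_unitary hY
  clear hY
  induction hspan using Submodule.span_induction with
  | mem V hV =>
    have hVV : Vᴴ * V = 1 := Unitary.star_mul_self_of_mem hV.2
    have h := congrArg (· * V) (hμ.conj_average hM hV.1 hV.2)
    simp only [Matrix.mul_assoc, hVV, Matrix.mul_one] at h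
    exact h.symm
  | zero => exact Commute.zero_right M
  | add _ _ _ _ h₁ h₂ => exact h₁.add_right h₂
  | smul c _ _ h => exact h.smul_right c

theorem trace_mul_average (hμ : IsHaar A μ) {X M : Matrix n n ℂ}
    (hM : ∀ i j, M i j = ∫ U, (U * X * Uᴴ) i j ∂μ) {W : Matrix n n ℂ}
    (hW : ∀ Z ∈ A, Commute W Z) : (W * M).trace = (W * X).trace := by
  have := hμ.1
  let L : Matrix n n ℂ →ₗ[ℂ] ℂ := Matrix.traceLinearMap n ℂ ℂ ∘ₗ LinearMap.mulLeft ℂ W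
  calc (W * M).trace = ∫ U, (W * (U * X * Uᴴ)).trace ∂μ := hμ.map_average hM L
    _ = ∫ _, (W * X).trace ∂μ := by
      refine integral_congr_ae ?_
      filter_upwards [hμ.ae_mem] with U hU
      have hUU : Uᴴ * U = 1 := Unitary.star_mul_self_of_mem hU.2
      rw [← Matrix.mul_assoc, Matrix.trace_mul_comm, ← Matrix.mul_assoc W, (hW U hU.1).eq,
        Matrix.mul_assoc U, ← Matrix.mul_assoc, hUU, Matrix.one_mul]
    _ = (W * X).trace := by simp

end IsHaar

/-- The Haar average `∫ U X U† dU` over the unitary group of a star-subalgebra `A`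
equals the Frobenius-orthogonal projection of `X` onto the commutant `A'`:
it lies in `A'` and `X` minus it is orthogonal to every element of `A'`. -/
theorem stmt_1 (d : ℕ) (hd : 0 < d)
    (A : StarSubalgebra ℂ (Matrix (Fin d) (Fin d) ℂ))
    (μ : Measure (Matrix (Fin d) (Fin d) ℂ)) (hμ : IsHaar A μ)
    (X M : Matrix (Fin d) (Fin d) ℂ)
    (hM : ∀ i j, M i j = ∫ U, (U * X * Uᴴ) i j ∂μ) :
    (∀ Y ∈ A, M * Y = Y * M) ∧
    ∀ Y : Matrix (Fin d) (Fin d) ℂ, (∀ Z ∈ A, Y * Z = Z * Y) →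
      Matrix.trace (Yᴴ * (X - M)) = 0 := by
  refine ⟨fun Y hY ↦ hμ.commute_average hM hY, fun Y hY ↦ ?_⟩
  have hYstar (Z : Matrix (Fin d) (Fin d) ℂ) (hZ : Z ∈ A) : Commute Yᴴ Z := by
    simpa [Matrix.star_eq_conjTranspose] using
      (show Commute Y (star Z) from hY _ (star_mem hZ)).star_star
  rw [Matrix.mul_sub, Matrix.trace_sub, hμ.trace_mul_average hM hYstar, sub_self]
end
end

section
/- Let A, B ⊆ M_d(ℂ) be hermitian-closed unital subalgebras, and set Ω_A := ∫_{U(A)} U ⊗ U† dU and Ω_B := ∫_{U(B)} V ⊗ V† dV (Kronecker products, normalized Haar averages). Then S(A:B) = 1 − (1/d)·Tr(S · Ω_A · Ω_B), where S is the swap matrix on ℂ^d ⊗ ℂ^d. -/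
open MeasureTheory Matrix Kronecker

noncomputable section

/-- The swap matrix `S ∈ M_{d²}(ℂ)`, `S((i,j),(k,l)) = δ_{i,l} δ_{j,k}`. -/
def swapMat (d : ℕ) : Matrix (Fin d × Fin d) (Fin d × Fin d) ℂ :=
  Matrix.of fun p q => if p.1 = q.2 ∧ p.2 = q.1 then 1 else 0

/-- `Ω := ∫ U ⊗ U† dμ(U)` (entrywise integral, Kronecker product). -/
def Omega {d : ℕ} (μ : Measure (Matrix (Fin d) (Fin d) ℂ)) :
    Matrix (Fin d × Fin d) (Fin d × Fin d) ℂ :=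
  Matrix.of fun p q => ∫ U, (U ⊗ₖ Uᴴ) p q ∂μ

instance matBorelSpace (n : Type*) [Fintype n] : BorelSpace (Matrix n n ℂ) :=
  show BorelSpace (n → n → ℂ) from inferInstance

instance matSecondCountableTopology (n : Type*) [Fintype n] :
    SecondCountableTopology (Matrix n n ℂ) :=
  show SecondCountableTopology (n → n → ℂ) from inferInstance

/-- The compact set of matrices all of whose entries lie in the closed unit disc. -/
def entryBall (n : Type*) : Set (Matrix n n ℂ) :=
  Set.univ.pi fun _ => Set.univ.pi fun _ => Metric.closedBall 0 1

theorem isCompact_entryBall {n : Type*} : IsCompact (entryBall n) :=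
  isCompact_univ_pi fun _ => isCompact_univ_pi fun _ => isCompact_closedBall 0 1

theorem integral_const_sub_mul_re {α : Type*} [MeasurableSpace α] {μ : Measure α}
    [IsProbabilityMeasure μ] {f : α → ℂ} (hf : Integrable f μ) (a b : ℝ) :
    ∫ x, (a - b * (f x).re) ∂μ = a - b * (∫ x, f x ∂μ).re := by
  have hre : ∫ x, (f x).re ∂μ = (∫ x, f x ∂μ).re := integral_re hf
  have hi : Integrable (fun x => b * (f x).re) μ := hf.re.const_mul b
  rw [integral_sub (integrable_const _) hi, integral_const_mul, hre]
  simp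

section Haar

variable {n : Type*} [Fintype n] [DecidableEq n] {A B : StarSubalgebra ℂ (Matrix n n ℂ)}
  {μ ν : Measure (Matrix n n ℂ)}

theorem IsHaar.ae_mem_s2 (h : IsHaar A μ) :
    ∀ᵐ U ∂μ, U ∈ A ∧ U ∈ unitary (Matrix n n ℂ) :=
  h.2.1

theorem IsHaar.restrict_entryBall (h : IsHaar A μ) : μ.restrict (entryBall n) = μ := by
  refine Measure.restrict_eq_self_of_ae_mem ?_
  filter_upwards [h.ae_mem_s2] with U hU i _ j _
  simpa using entry_norm_bound_of_unitary hU.2 i j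

theorem IsHaar.integrable (h : IsHaar A μ) {f : Matrix n n ℂ → ℂ} (hf : Continuous f) :
    Integrable f μ := by
  have := h.1
  rw [← h.restrict_entryBall]
  exact hf.continuousOn.integrableOn_compact isCompact_entryBall

theorem IsHaar.integrable_prod (hμ : IsHaar A μ) (hν : IsHaar B ν)
    {f : Matrix n n ℂ × Matrix n n ℂ → ℂ} (hf : Continuous f) :
    Integrable f (μ.prod ν) := by
  have := hμ.1
  have := hν.1
  rw [← hμ.restrict_entryBall, ← hν.restrict_entryBall, Measure.prod_restrict]
  exact hf.continuousOn.integrableOn_compact (isCompact_entryBall.prod isCompact_entryBall)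

theorem IsHaar.integral_mul_left (h : IsHaar A μ) {U : Matrix n n ℂ} (hU : U ∈ A)
    (hU' : U ∈ unitary (Matrix n n ℂ)) {f : Matrix n n ℂ → ℂ} (hf : Continuous f) :
    ∫ V, f (U * V) ∂μ = ∫ V, f V ∂μ := by
  have hm : Continuous fun V : Matrix n n ℂ => U * V := by fun_prop
  conv_rhs => rw [← h.2.2 U hU hU']
  rw [integral_map hm.measurable.aemeasurable hf.aestronglyMeasurable]

theorem IsHaar.integral_conjTranspose (h : IsHaar A μ) {f : Matrix n n ℂ → ℂ}
    (hf : Continuous f) : ∫ V, f Vᴴ ∂μ = ∫ V, f V ∂μ := by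
  have := h.1
  calc ∫ V, f Vᴴ ∂μ = ∫ _U, ∫ V, f Vᴴ ∂μ ∂μ := by simp
    _ = ∫ U, ∫ V, f (Vᴴ * U) ∂μ ∂μ := by
        refine integral_congr_ae ?_
        filter_upwards [h.ae_mem_s2] with U hU
        rw [← h.integral_mul_left (star_mem hU.1) (Unitary.star_mem hU.2)
          (f := fun V => f Vᴴ) (by fun_prop)]
        simp [star_eq_conjTranspose]
    _ = ∫ V, ∫ U, f (Vᴴ * U) ∂μ ∂μ :=
        integral_integral_swap (h.integrable_prod h (by fun_prop))
    _ = ∫ _V, ∫ U, f U ∂μ ∂μ := by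
        refine integral_congr_ae ?_
        filter_upwards [h.ae_mem_s2] with V hV
        exact h.integral_mul_left (star_mem hV.1) (Unitary.star_mem hV.2) hf
    _ = ∫ V, f V ∂μ := by simp

/-- The average over `V` of `Tr(U V U† V†)` is real. -/
theorem IsHaar.ofReal_re_integral_trace_commutator (h : IsHaar A μ) (U : Matrix n n ℂ) :
    (((∫ V, trace (U * V * Uᴴ * Vᴴ) ∂μ).re : ℝ) : ℂ) = ∫ V, trace (U * V * Uᴴ * Vᴴ) ∂μ := by
  rw [← Complex.conj_eq_iff_re, ← integral_conj,
    ← h.integral_conjTranspose (f := fun V => trace (U * V * Uᴴ * Vᴴ)) (by fun_prop)]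
  refine integral_congr_ae (.of_forall fun V => ?_)
  dsimp only
  rw [starRingEnd_apply, ← trace_conjTranspose]
  simp only [conjTranspose_mul, conjTranspose_conjTranspose]
  rw [trace_mul_comm, trace_mul_comm]
  simp only [Matrix.mul_assoc]
  rw [trace_mul_comm]
  simp only [Matrix.mul_assoc]

theorem hs2_commutator {U V : Matrix n n ℂ} (hU : U ∈ unitary (Matrix n n ℂ))
    (hV : V ∈ unitary (Matrix n n ℂ)) :
    hs2 (U * V - V * U) = 2 * (Fintype.card n : ℝ) - 2 * (trace (U * V * Uᴴ * Vᴴ)).re := by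
  have norm_one {W : Matrix n n ℂ} (hW : W ∈ unitary (Matrix n n ℂ)) : Wᴴ * W = 1 :=
    Unitary.star_mul_self_of_mem hW
  have hUV := norm_one (mul_mem hU hV)
  have hVU := norm_one (mul_mem hV hU)
  have h₁ : trace ((V * U)ᴴ * (U * V)) = trace (U * V * Uᴴ * Vᴴ) := by
    rw [trace_mul_comm, conjTranspose_mul]
    simp only [Matrix.mul_assoc]
  have h₂ : trace ((U * V)ᴴ * (V * U)) = star (trace (U * V * Uᴴ * Vᴴ)) := by
    rw [← h₁, ← trace_conjTranspose, conjTranspose_mul _ (U * V), conjTranspose_conjTranspose]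
  rw [hs2, conjTranspose_sub, Matrix.sub_mul, Matrix.mul_sub, Matrix.mul_sub, hUV, hVU]
  simp only [trace_sub, h₁, h₂, trace_one, Complex.sub_re, Complex.natCast_re, Complex.star_def,
    Complex.conj_re]
  ring

end Haar

theorem trace_swapMat_mul {d : ℕ} (M N : Matrix (Fin d × Fin d) (Fin d × Fin d) ℂ) :
    trace (swapMat d * M * N) = ∑ p, ∑ q, M p.swap q * N q p := by
  have h (p q : Fin d × Fin d) : swapMat d p q = if q = p.swap then 1 else 0 := by
    simp [swapMat, Prod.ext_iff, eq_comm, and_comm]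
  simp [trace, Matrix.mul_assoc, Matrix.mul_apply, h]

theorem trace_swapMat_mul_kronecker {d : ℕ} (U V : Matrix (Fin d) (Fin d) ℂ) :
    ∑ p : Fin d × Fin d, ∑ q, (U ⊗ₖ Uᴴ) p.swap q * (V ⊗ₖ Vᴴ) q p
      = trace (U * V * Uᴴ * Vᴴ) := by
  rw [← trace_swapMat_mul, Matrix.mul_assoc, ← mul_kronecker_mul, Matrix.mul_assoc (U * V),
    ← Matrix.mul_one (swapMat d * _), trace_swapMat_mul, trace, Fintype.sum_prod_type_right]
  simp [Matrix.one_apply, Matrix.mul_apply (M := U * V), Prod.swap]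

theorem trace_swapMat_mul_Omega {d : ℕ} {A B : StarSubalgebra ℂ (Matrix (Fin d) (Fin d) ℂ)}
    {μ ν : Measure (Matrix (Fin d) (Fin d) ℂ)} (hμ : IsHaar A μ) (hν : IsHaar B ν) :
    trace (swapMat d * Omega μ * Omega ν) = ∫ U, ∫ V, trace (U * V * Uᴴ * Vᴴ) ∂ν ∂μ := by
  have hc (p q : Fin d × Fin d) :
      Continuous fun U : Matrix (Fin d) (Fin d) ℂ => (U ⊗ₖ Uᴴ) p q := by
    simp only [kroneckerMap_apply]
    fun_prop
  have hV (U : Matrix (Fin d) (Fin d) ℂ) : ∫ V, trace (U * V * Uᴴ * Vᴴ) ∂ν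
      = ∑ p : Fin d × Fin d, ∑ q, (U ⊗ₖ Uᴴ) p.swap q * Omega ν q p := by
    simp_rw [← trace_swapMat_mul_kronecker]
    have hi (p q : Fin d × Fin d) := (hν.integrable (hc q p)).const_mul ((U ⊗ₖ Uᴴ) p.swap q)
    rw [integral_finsetSum _ fun p _ => integrable_finsetSum _ fun q _ => hi p q]
    simp_rw [integral_finsetSum Finset.univ fun q _ => hi _ q, integral_const_mul, Omega, of_apply]
  have hi (p q : Fin d × Fin d) := (hμ.integrable (hc p.swap q)).mul_const (Omega ν q p)
  simp_rw [hV]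
  rw [integral_finsetSum _ fun p _ => integrable_finsetSum _ fun q _ => hi p q, trace_swapMat_mul]
  simp_rw [integral_finsetSum Finset.univ fun q _ => hi _ q, integral_mul_const, Omega, of_apply]

/-- `S(A:B) = 1 - (1/d) Tr(S Ω_A Ω_B)`. -/
theorem stmt_2 (d : ℕ) (hd : 0 < d)
    (A B : StarSubalgebra ℂ (Matrix (Fin d) (Fin d) ℂ))
    (μ ν : Measure (Matrix (Fin d) (Fin d) ℂ))
    (hμ : IsHaar A μ) (hν : IsHaar B ν) :
    (MAN μ ν : ℂ) = 1 - (1 / (d : ℂ)) * Matrix.trace (swapMat d * Omega μ * Omega ν) := by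
  have := hμ.1
  have := hν.1
  have hprod : Integrable (fun p : Matrix (Fin d) (Fin d) ℂ × Matrix (Fin d) (Fin d) ℂ =>
      trace (p.1 * p.2 * p.1ᴴ * p.2ᴴ)) (μ.prod ν) := hμ.integrable_prod hν (by fun_prop)
  have key : ∫ U, ∫ V, hs2 (U * V - V * U) ∂ν ∂μ
      = ∫ U, (2 * (d : ℝ) - 2 * (∫ V, trace (U * V * Uᴴ * Vᴴ) ∂ν).re) ∂μ := by
    refine integral_congr_ae ?_
    filter_upwards [hμ.ae_mem_s2] with U hU
    calc ∫ V, hs2 (U * V - V * U) ∂ν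
        = ∫ V, (2 * (d : ℝ) - 2 * (trace (U * V * Uᴴ * Vᴴ)).re) ∂ν := by
          refine integral_congr_ae ?_
          filter_upwards [hν.ae_mem_s2] with V hV
          simpa using hs2_commutator hU.2 hV.2
      _ = _ := integral_const_sub_mul_re (hν.integrable (by fun_prop)) _ _
  have hreal : (((∫ U, ∫ V, trace (U * V * Uᴴ * Vᴴ) ∂ν ∂μ).re : ℝ) : ℂ)
      = ∫ U, ∫ V, trace (U * V * Uᴴ * Vᴴ) ∂ν ∂μ := by
    rw [← integral_congr_ae (.of_forall hν.ofReal_re_integral_trace_commutator),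
      integral_complex_ofReal, Complex.ofReal_re]
  have hd' : (d : ℂ) ≠ 0 := by exact_mod_cast hd.ne'
  rw [MAN, key, integral_const_sub_mul_re hprod.integral_prod_left, trace_swapMat_mul_Omega hμ hν,
    ← hreal, Fintype.card_fin, Complex.ofReal_re]
  push_cast
  field_simp
end
end

section
/- Let {e_α}_{α∈I} and {f_β}_{β∈J} be finite families in M_d(ℂ) satisfying Σ_α e_α e_α† = 1_d and Σ_β f_β f_β† = 1_d, which are hermitian-closed in the sense that there exist involutive bijections σ : I → I and τ : J → J with e_{σ(α)} = e_α† for all α and f_{τ(β)} = f_β† for all β. Set Ω_A := Σ_α e_α ⊗ e_α† and Ω_B := Σ_β f_β ⊗ f_β†. Then Tr(S · Ω_A · Ω_B) = d − (1/2) Σ_{α∈I} Σ_{β∈J} ‖e_α f_β − f_β e_α‖₂². -/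
open Matrix Kronecker

noncomputable section

lemma ofReal_hs2 {n : Type*} [Fintype n] (X : Matrix n n ℂ) :
    ((hs2 X : ℝ) : ℂ) = Matrix.trace (Xᴴ * X) := by
  refine Complex.conj_eq_iff_re.mp ?_
  rw [starRingEnd_apply, ← Matrix.trace_conjTranspose, Matrix.conjTranspose_mul,
    Matrix.conjTranspose_conjTranspose]

lemma trace_swapMat_mul_kronecker_s3 (d : ℕ) (a b : Matrix (Fin d) (Fin d) ℂ) :
    Matrix.trace (swapMat d * (a ⊗ₖ b)) = Matrix.trace (a * b) := by
  have h : ∀ p : Fin d × Fin d, (swapMat d * (a ⊗ₖ b)) p p = a p.2 p.1 * b p.1 p.2 := by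
    rintro ⟨i, j⟩
    rw [Matrix.mul_apply, Finset.sum_eq_single (j, i)]
    · simp [swapMat]
    · rintro ⟨k, l⟩ - hne
      have : ¬(i = l ∧ j = k) := fun ⟨h₁, h₂⟩ => hne (by rw [h₁, h₂])
      simp [swapMat, this]
    · simp
  simp only [Matrix.trace, Matrix.diag_apply, h, Fintype.sum_prod_type, Matrix.mul_apply]
  exact Finset.sum_comm

lemma ofReal_hs2_commutator {n : Type*} [Fintype n] (a b : Matrix n n ℂ) :
    ((hs2 (a * b - b * a) : ℝ) : ℂ)
      = Matrix.trace (aᴴ * a * (b * bᴴ)) + Matrix.trace (bᴴ * b * (a * aᴴ))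
        - Matrix.trace (a * b * (aᴴ * bᴴ)) - Matrix.trace (aᴴ * b * (a * bᴴ)) := by
  have h₁ : Matrix.trace (bᴴ * aᴴ * (a * b)) = Matrix.trace (aᴴ * a * (b * bᴴ)) := by
    rw [Matrix.mul_assoc, Matrix.trace_mul_comm]
    simp only [Matrix.mul_assoc]
  have h₂ : Matrix.trace (aᴴ * bᴴ * (b * a)) = Matrix.trace (bᴴ * b * (a * aᴴ)) := by
    rw [Matrix.mul_assoc, Matrix.trace_mul_comm]
    simp only [Matrix.mul_assoc]
  have h₃ : Matrix.trace (aᴴ * bᴴ * (a * b)) = Matrix.trace (a * b * (aᴴ * bᴴ)) :=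
    Matrix.trace_mul_comm _ _
  have h₄ : Matrix.trace (bᴴ * aᴴ * (b * a)) = Matrix.trace (aᴴ * b * (a * bᴴ)) := by
    rw [Matrix.mul_assoc, Matrix.trace_mul_comm]
    simp only [Matrix.mul_assoc]
  rw [ofReal_hs2, Matrix.conjTranspose_sub, Matrix.conjTranspose_mul, Matrix.conjTranspose_mul,
    Matrix.sub_mul, Matrix.mul_sub, Matrix.mul_sub]
  simp only [Matrix.trace_sub, h₁, h₂, h₃, h₄]
  ring

lemma sum_trace_conjTranspose_mul_self_mul {n ι κ : Type*} [Fintype n] [DecidableEq n]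
    [Fintype ι] [Fintype κ] (a : ι → Matrix n n ℂ) (b : κ → Matrix n n ℂ)
    (ha : ∑ i, a i * (a i)ᴴ = 1) (hb : ∑ k, b k * (b k)ᴴ = 1) :
    ∑ i, ∑ k, Matrix.trace ((a i)ᴴ * a i * (b k * (b k)ᴴ)) = (Fintype.card n : ℂ) := by
  simp_rw [← Matrix.trace_sum, ← Matrix.mul_sum, hb, Matrix.mul_one]
  rw [← Matrix.trace_one (R := ℂ), ← ha, Matrix.trace_sum, Matrix.trace_sum]
  exact Finset.sum_congr rfl fun i _ => Matrix.trace_mul_comm _ _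

/-- For hermitian-closed families `{e_α}`, `{f_β}` with `Σ e_α e_α† = Σ f_β f_β† = 1`:
`Tr(S Ω_A Ω_B) = d - (1/2) Σ_{α,β} ‖[e_α, f_β]‖₂²`. -/
theorem stmt_3 (d : ℕ) (I J : Type*) [Fintype I] [Fintype J]
    (e : I → Matrix (Fin d) (Fin d) ℂ) (f : J → Matrix (Fin d) (Fin d) ℂ)
    (he1 : ∑ α, e α * (e α)ᴴ = 1) (hf1 : ∑ β, f β * (f β)ᴴ = 1)
    (σ : I → I) (hσ : Function.Involutive σ) (hσe : ∀ α, e (σ α) = (e α)ᴴ)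
    (τ : J → J) (hτ : Function.Involutive τ) (hτf : ∀ β, f (τ β) = (f β)ᴴ) :
    Matrix.trace (swapMat d * (∑ α, e α ⊗ₖ (e α)ᴴ) * (∑ β, f β ⊗ₖ (f β)ᴴ))
      = (d : ℂ) - (1 / 2 : ℂ) * ((∑ α, ∑ β, hs2 (e α * f β - f β * e α) : ℝ) : ℂ) := by
  have hL : Matrix.trace (swapMat d * (∑ α, e α ⊗ₖ (e α)ᴴ) * (∑ β, f β ⊗ₖ (f β)ᴴ))
      = ∑ α, ∑ β, Matrix.trace (e α * f β * ((e α)ᴴ * (f β)ᴴ)) := by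
    rw [Matrix.mul_assoc]
    simp_rw [Matrix.sum_mul, Matrix.mul_sum, Matrix.trace_sum, ← Matrix.mul_kronecker_mul,
      trace_swapMat_mul_kronecker_s3]
  have hσsum : ∑ α, ∑ β, Matrix.trace ((e α)ᴴ * f β * (e α * (f β)ᴴ))
      = ∑ α, ∑ β, Matrix.trace (e α * f β * ((e α)ᴴ * (f β)ᴴ)) := by
    rw [← Equiv.sum_comp hσ.toPerm]
    simp [hσe]
  have h₁ := sum_trace_conjTranspose_mul_self_mul e f he1 hf1
  have h₂ := sum_trace_conjTranspose_mul_self_mul f e hf1 he1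
  rw [Finset.sum_comm] at h₂
  rw [Fintype.card_fin] at h₁ h₂
  rw [hL]
  push_cast
  simp_rw [ofReal_hs2_commutator, Finset.sum_sub_distrib, Finset.sum_add_distrib]
  rw [h₁, h₂, hσsum]
  ring
end
end

section
/- Let {v_i}_{i=1}^d and {w_j}_{j=1}^d be two orthonormal bases of ℂ^d. Define the relative quantumness Q := sup over real vectors a ∈ ℝ^d with Σ_j a_j² = 1 of (1/d) Σ_{i=1}^d ( ⟨v_i, A² v_i⟩ − ⟨v_i, A v_i⟩² ), where A := Σ_j a_j · w_j w_j† (a hermitian matrix). Then Q ≤ (1/d) Σ_{i=1}^d (1 − Σ_{j=1}^d |⟨v_i, w_j⟩|⁴) ≤ d·Q. (The middle quantity equals the Mutual Averaged Non-commutativity of the two maximal abelian algebras diagonal in the bases {v_i} and {w_j}.) -/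
open Matrix

noncomputable section

theorem re_star_dotProduct_sum_rankOne {d : ℕ} (u : Fin d → ℂ) (w : Fin d → Fin d → ℂ)
    (a : Fin d → ℝ) :
    (∑ k, star (u k) *
      ((∑ j, (a j : ℂ) • Matrix.of (fun k l => w j k * star (w j l))).mulVec u) k).re
      = ∑ j, a j * ‖∑ k, star (u k) * w j k‖ ^ 2 := by
  have key : (∑ k, star (u k) *
      ((∑ j, (a j : ℂ) • Matrix.of (fun k l => w j k * star (w j l))).mulVec u) k)
      = ∑ j, (a j : ℂ) * ((∑ k, star (u k) * w j k) * star (∑ k, star (u k) * w j k)) := by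
    simp only [Matrix.mulVec, dotProduct, Matrix.sum_apply, Matrix.smul_apply, Matrix.of_apply,
      smul_eq_mul, star_sum, star_mul', star_star, Finset.sum_mul, Finset.mul_sum]
    rw [Finset.sum_congr rfl fun k _ => Finset.sum_comm, Finset.sum_comm]
    refine Finset.sum_congr rfl fun j _ => ?_
    rw [Finset.sum_comm]
    refine Finset.sum_congr rfl fun l _ => Finset.sum_congr rfl fun k _ => ?_
    ring
  rw [key, Complex.re_sum]
  refine Finset.sum_congr rfl fun j _ => ?_
  rw [← starRingEnd_apply, Complex.mul_conj, ← Complex.ofReal_mul, Complex.ofReal_re,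
    Complex.normSq_eq_norm_sq]

theorem sum_rankOne_mul_self {d : ℕ} (w : Fin d → Fin d → ℂ)
    (hw : ∀ i j, (∑ k, star (w i k) * w j k) = if i = j then 1 else 0) (a : Fin d → ℝ) :
    (∑ j, (a j : ℂ) • Matrix.of (fun k l => w j k * star (w j l))) *
      (∑ j, (a j : ℂ) • Matrix.of (fun k l => w j k * star (w j l)))
      = ∑ j, ((a j ^ 2 : ℝ) : ℂ) • Matrix.of (fun k l => w j k * star (w j l)) := by
  have hmul : ∀ i j, Matrix.of (fun k l => w i k * star (w i l)) *
      Matrix.of (fun k l => w j k * star (w j l))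
      = if i = j then Matrix.of (fun k l => w i k * star (w i l)) else 0 := by
    intro i j
    have h1 : Matrix.of (fun k l => w i k * star (w i l)) *
        Matrix.of (fun k l => w j k * star (w j l))
        = (∑ k, star (w i k) * w j k) • Matrix.of (fun k l => w i k * star (w j l)) := by
      ext k l
      simp only [Matrix.mul_apply, Matrix.of_apply, Matrix.smul_apply, smul_eq_mul,
        Finset.sum_mul]
      exact Finset.sum_congr rfl fun m _ => by ring
    rw [h1, hw]
    split_ifs with h
    · rw [h, one_smul]
    · rw [zero_smul]
  simp only [Finset.sum_mul_sum, smul_mul_smul_comm, hmul, smul_ite, smul_zero,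
    Finset.sum_ite_eq, Finset.mem_univ, if_true, Complex.ofReal_mul, sq]

theorem sum_norm_sq_inner_eq_one {d : ℕ} (u : Fin d → ℂ) (hu : ∑ k, star (u k) * u k = 1)
    (w : Fin d → Fin d → ℂ)
    (hw : ∀ i j, (∑ k, star (w i k) * w j k) = if i = j then 1 else 0) :
    ∑ j, ‖∑ k, star (u k) * w j k‖ ^ 2 = 1 := by
  have h := re_star_dotProduct_sum_rankOne u w (fun _ => 1)
  have hW : (Matrix.of fun i k => star (w i k)) * (Matrix.of fun k j => w j k) = 1 := by
    ext i j
    simp only [Matrix.mul_apply, Matrix.of_apply, hw, Matrix.one_apply]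
  have hone : (∑ j, ((1 : ℝ) : ℂ) • Matrix.of (fun k l => w j k * star (w j l))) = 1 := by
    rw [← mul_eq_one_comm.mp hW]
    ext k l
    simp [Matrix.sum_apply, Matrix.mul_apply]
  rw [hone] at h
  simp only [Matrix.one_mulVec, hu, Complex.one_re, one_mul] at h
  exact h.symm

theorem variance_le_one_sub_sum_sq {ι : Type*} [Fintype ι] [DecidableEq ι] (p a : ι → ℝ)
    (hp : ∀ j, 0 ≤ p j) (hp1 : ∑ j, p j = 1) (ha : ∑ j, a j ^ 2 = 1) :
    ∑ j, a j ^ 2 * p j - (∑ j, a j * p j) ^ 2 ≤ 1 - ∑ j, p j ^ 2 := by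
  have hpair : ∀ j k, (a j - a k) ^ 2 / 2 ≤ 1 - if j = k then 1 else 0 := by
    intro j k
    split_ifs with h
    · simp [h]
    · have h2 : a j ^ 2 + a k ^ 2 ≤ 1 := by
        rw [← ha, ← Finset.sum_pair (f := fun i => a i ^ 2) h]
        exact Finset.sum_le_sum_of_subset_of_nonneg (Finset.subset_univ _)
          fun i _ _ => sq_nonneg _
      nlinarith [sq_nonneg (a j + a k)]
  have hsum : ∑ j, ∑ k, p j * p k * ((a j - a k) ^ 2 / 2)
      ≤ ∑ j, ∑ k, p j * p k * (1 - if j = k then 1 else 0) :=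
    Finset.sum_le_sum fun j _ => Finset.sum_le_sum fun k _ =>
      mul_le_mul_of_nonneg_left (hpair j k) (mul_nonneg (hp j) (hp k))
  have hl : ∑ j, ∑ k, p j * p k * ((a j - a k) ^ 2 / 2)
      = ∑ j, a j ^ 2 * p j - (∑ j, a j * p j) ^ 2 := by
    have hexp : ∀ j k, p j * p k * ((a j - a k) ^ 2 / 2)
        = (a j ^ 2 * p j) * p k / 2 + p j * (a k ^ 2 * p k) / 2 - (a j * p j) * (a k * p k) :=
      fun j k => by ring
    simp only [hexp, Finset.sum_add_distrib, Finset.sum_sub_distrib, ← Finset.sum_div,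
      ← Finset.sum_mul_sum, hp1]
    ring
  have hr : ∑ j, ∑ k, p j * p k * (1 - if j = k then 1 else 0) = 1 - ∑ j, p j ^ 2 := by
    simp only [mul_sub, mul_one, mul_ite, mul_zero, Finset.sum_sub_distrib,
      Finset.sum_ite_eq, Finset.mem_univ, if_true, ← Finset.sum_mul_sum, hp1, sq]
  rwa [hl, hr] at hsum

/-- `Q ≤ (1/d) Σ_i (1 - Σ_j |⟨v_i,w_j⟩|⁴) ≤ d Q`, where `Q` is the relative quantumness:
the sup over real `a` with `Σ a_j² = 1` of the mean variance of `A = Σ_j a_j w_j w_j†`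
in the states `v_i`. -/
theorem stmt_10 (d : ℕ) (hd : 0 < d) (v w : Fin d → Fin d → ℂ)
    (hv : ∀ i j, (∑ k, star (v i k) * v j k) = if i = j then 1 else 0)
    (hw : ∀ i j, (∑ k, star (w i k) * w j k) = if i = j then 1 else 0)
    (Amat : (Fin d → ℝ) → Matrix (Fin d) (Fin d) ℂ)
    (hAmat : ∀ a, Amat a = ∑ j, (a j : ℂ) • Matrix.of (fun k l => w j k * star (w j l)))
    (Q : ℝ)
    (hQ : Q = sSup {x : ℝ | ∃ a : Fin d → ℝ, (∑ j, (a j) ^ 2) = 1 ∧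
      x = (1 / (d : ℝ)) * ∑ i,
        ((∑ k, star (v i k) * ((Amat a * Amat a).mulVec (v i)) k).re
          - ((∑ k, star (v i k) * ((Amat a).mulVec (v i)) k).re) ^ 2)}) :
    Q ≤ (1 / (d : ℝ)) * ∑ i, (1 - ∑ j, ‖∑ k, star (v i k) * w j k‖ ^ 4) ∧
    (1 / (d : ℝ)) * ∑ i, (1 - ∑ j, ‖∑ k, star (v i k) * w j k‖ ^ 4) ≤ (d : ℝ) * Q := by
  have hA2 : ∀ a, Amat a * Amat a = Amat fun j => a j ^ 2 := fun a => by
    simp only [hAmat]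
    exact sum_rankOne_mul_self w hw a
  have hA : ∀ a i, (∑ k, star (v i k) * ((Amat a).mulVec (v i)) k).re
      = ∑ j, a j * ‖∑ k, star (v i k) * w j k‖ ^ 2 := fun a i => by
    rw [hAmat]
    exact re_star_dotProduct_sum_rankOne (v i) w a
  simp only [hA2, hA] at hQ
  have h4 : ∀ i j, ‖∑ k, star (v i k) * w j k‖ ^ 4 = (‖∑ k, star (v i k) * w j k‖ ^ 2) ^ 2 :=
    fun i j => by ring
  simp only [h4]
  have hp1 : ∀ i, ∑ j, ‖∑ k, star (v i k) * w j k‖ ^ 2 = 1 := fun i =>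
    sum_norm_sq_inner_eq_one (v i) (by simpa using hv i i) w hw
  have hp : ∀ i j, 0 ≤ ‖∑ k, star (v i k) * w j k‖ ^ 2 := fun i j => sq_nonneg _
  set p : Fin d → Fin d → ℝ := fun i j => ‖∑ k, star (v i k) * w j k‖ ^ 2
  change ∀ i, ∑ j, p i j = 1 at hp1
  change ∀ i j, 0 ≤ p i j at hp
  set S : Set ℝ := {x : ℝ | ∃ a : Fin d → ℝ, (∑ j, (a j) ^ 2) = 1 ∧
      x = (1 / (d : ℝ)) * ∑ i, (∑ j, a j ^ 2 * p i j - (∑ j, a j * p i j) ^ 2)}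
  change Q = sSup S at hQ
  change Q ≤ (1 / (d : ℝ)) * ∑ i, (1 - ∑ j, p i j ^ 2) ∧
    (1 / (d : ℝ)) * ∑ i, (1 - ∑ j, p i j ^ 2) ≤ d * Q
  have hub : ∀ x ∈ S, x ≤ (1 / (d : ℝ)) * ∑ i, (1 - ∑ j, p i j ^ 2) := by
    rintro x ⟨a, ha, rfl⟩
    refine mul_le_mul_of_nonneg_left (Finset.sum_le_sum fun i _ => ?_) (by positivity)
    exact variance_le_one_sub_sum_sq (p i) a (hp i) (hp1 i) ha
  have hmem : ∀ j, (1 / (d : ℝ)) * ∑ i, (p i j - p i j ^ 2) ∈ S := fun j =>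
    ⟨Pi.single j 1, by simp [Pi.single_apply], by simp [Pi.single_apply]⟩
  rw [hQ]
  refine ⟨csSup_le ⟨_, hmem ⟨0, hd⟩⟩ hub, ?_⟩
  calc (1 / (d : ℝ)) * ∑ i, (1 - ∑ j, p i j ^ 2)
      = ∑ j, (1 / (d : ℝ)) * ∑ i, (p i j - p i j ^ 2) := by
        rw [← Finset.mul_sum, Finset.sum_comm]
        simp only [Finset.sum_sub_distrib, hp1]
    _ ≤ ∑ _j : Fin d, sSup S := Finset.sum_le_sum fun j _ => le_csSup ⟨_, hub⟩ (hmem j)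
    _ = d * sSup S := by simp
end
end
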